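/- arXiv:2102.09591 — 2 statements merged into one kernel-verified Lean document; each statement's English description precedes it below -/
import Mathlib

section
/- Suppose κ is a regular uncountable cardinal, S ⊆ κ is stationary in κ, and for each α ∈ S the set S_α ⊆ α is a subtle subset of α. Then ⋃_{α∈S} S_α is a subtle subset of κ. -/
namespace LCI


/-- `κ` is (the initial ordinal of) a regular uncountable cardinal. -/
def RegUncountable (kappa : Ordinal.{0}) : Prop :=
  Ordinal.omega0 < kappa ∧ kappa.cof.ord = kappa

/-- `C` is a club (closed unbounded) subset of the ordinal `κ`. -/
def IsClubIn (C : Set Ordinal.{0}) (kappa : Ordinal.{0}) : Prop :=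
  C ⊆ Set.Iio kappa ∧
  (∀ alpha < kappa, ∃ beta ∈ C, alpha < beta) ∧
  ∀ beta < kappa, beta ≠ 0 →
    (∀ gamma < beta, ∃ delta ∈ C, gamma < delta ∧ delta < beta) → beta ∈ C

/-- `S` is a stationary subset of the ordinal `κ`. -/
def IsStationaryIn (S : Set Ordinal.{0}) (kappa : Ordinal.{0}) : Prop :=
  S ⊆ Set.Iio kappa ∧ ∀ C, IsClubIn C kappa → (S ∩ C).Nonempty

/-- `H` is homogeneous for the list `L` (where `L α ⊆ α` on the relevant domain):
whenever `α < β` are both in `H`, `L α = L β ∩ α`. -/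
def Homog (L : Ordinal.{0} → Set Ordinal.{0}) (H : Set Ordinal.{0}) : Prop :=
  ∀ alpha ∈ H, ∀ beta ∈ H, alpha < beta → L alpha = L beta ∩ Set.Iio alpha

/-- `S ⊆ κ` is a subtle subset of `κ`: for every `S`-list `L` (i.e. `L α ⊆ α` for
`α ∈ S`) and every club `C ⊆ κ` there are `α < β` in `S ∩ C` with `L α = L β ∩ α`. -/
def IsSubtleIn (S : Set Ordinal.{0}) (kappa : Ordinal.{0}) : Prop :=
  S ⊆ Set.Iio kappa ∧
  ∀ L : Ordinal.{0} → Set Ordinal.{0}, (∀ alpha ∈ S, L alpha ⊆ Set.Iio alpha) →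
    ∀ C, IsClubIn C kappa →
      ∃ alpha ∈ S ∩ C, ∃ beta ∈ S ∩ C, alpha < beta ∧ L alpha = L beta ∩ Set.Iio alpha

/-- The nonzero limit points below `κ` of a set of ordinals. -/
def limitPoints (C : Set Ordinal.{0}) (kappa : Ordinal.{0}) : Set Ordinal.{0} :=
  {beta | beta < kappa ∧ beta ≠ 0 ∧ ∀ gamma < beta, ∃ delta ∈ C, gamma < delta ∧ delta < beta}

/-- A regular uncountable cardinal has uncountable cofinality. -/
theorem RegUncountable.aleph0_lt_cof {kappa : Ordinal.{0}} (hreg : RegUncountable kappa) :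
    Cardinal.aleph0 < kappa.cof := by
  rw [← Cardinal.ord_lt_ord, Cardinal.ord_aleph0, hreg.2]
  exact hreg.1

/-- The limit points of a club in a regular uncountable cardinal form a club. -/
theorem IsClubIn.limitPoints {C : Set Ordinal.{0}} {kappa : Ordinal.{0}}
    (hreg : RegUncountable kappa) (hC : IsClubIn C kappa) :
    IsClubIn (limitPoints C kappa) kappa := by
  obtain ⟨hsub, hunb, -⟩ := hC
  refine ⟨fun _ h => h.1, fun alpha halpha => ?_, fun beta hbeta hne hlim => ⟨hbeta, hne, ?_⟩⟩
  · choose! f hfC hlt using hunb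
    have hmem (n : ℕ) : f^[n] alpha < kappa := by
      induction n with
      | zero => exact halpha
      | succ n ih =>
        rw [Function.iterate_succ_apply']
        exact hsub (hfC _ ih)
    have hstep (n : ℕ) : f^[n] alpha < f^[n + 1] alpha := by
      rw [Function.iterate_succ_apply']
      exact hlt _ (hmem n)
    have hbelow (n : ℕ) : f^[n] alpha < ⨆ m, f^[m] alpha :=
      (hstep n).trans_le (Ordinal.le_iSup (fun m => f^[m] alpha) (n + 1))
    refine ⟨⨆ n, f^[n] alpha, ⟨?_, (zero_le.trans_lt (hbelow 0)).ne', ?_⟩, hbelow 0⟩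
    · exact Ordinal.iSup_lt_of_lt_cof (by simpa using hreg.aleph0_lt_cof) hmem
    · intro gamma hgamma
      obtain ⟨n, hn⟩ := (Ordinal.lt_iSup_iff).1 hgamma
      refine ⟨f^[n + 1] alpha, ?_, hn.trans (hstep n), hbelow _⟩
      rw [Function.iterate_succ_apply']
      exact hfC _ (hmem n)
  · intro gamma hgamma
    obtain ⟨delta, hdelta, hgd, hdb⟩ := hlim gamma hgamma
    obtain ⟨epsilon, hepsilon, hge, hed⟩ := hdelta.2.2 gamma hgd
    exact ⟨epsilon, hepsilon, hge, hed.trans hdb⟩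

/-- A club restricts to a club in each of its limit points. -/
theorem IsClubIn.inter_Iio {C : Set Ordinal.{0}} {kappa alpha : Ordinal.{0}}
    (hC : IsClubIn C kappa) (halpha : alpha ∈ LCI.limitPoints C kappa) :
    IsClubIn (C ∩ Set.Iio alpha) alpha := by
  refine ⟨Set.inter_subset_right, fun gamma hgamma => ?_, fun beta hbeta hne hlim => ⟨?_, hbeta⟩⟩
  · obtain ⟨delta, hdelta, hgd, hda⟩ := halpha.2.2 gamma hgamma
    exact ⟨delta, ⟨hdelta, hda⟩, hgd⟩
  · refine hC.2.2 beta (hbeta.trans halpha.1) hne fun gamma hgamma => ?_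
    obtain ⟨delta, hdelta, h⟩ := hlim gamma hgamma
    exact ⟨delta, hdelta.1, h⟩

/-- If `S` is stationary in `κ` and `F α` is a subtle subset of `α` for
each `α ∈ S`, then `⋃_{α ∈ S} F α` is a subtle subset of `κ`. -/
theorem subtle_of_stationary_union (kappa : Ordinal.{0}) (hreg : RegUncountable kappa)
    (S : Set Ordinal.{0}) (hS : IsStationaryIn S kappa)
    (F : Ordinal.{0} → Set Ordinal.{0}) (hF : ∀ alpha ∈ S, IsSubtleIn (F alpha) alpha) :
    IsSubtleIn (⋃ alpha ∈ S, F alpha) kappa := by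
  refine ⟨Set.iUnion₂_subset fun alpha halpha gamma hgamma =>
    Set.mem_Iio.2 (lt_trans ((hF alpha halpha).1 hgamma) (hS.1 halpha)), fun L hL C hC => ?_⟩
  obtain ⟨alpha, halphaS, halpha⟩ := hS.2 _ (hC.limitPoints hreg)
  have hsub : F alpha ⊆ ⋃ alpha ∈ S, F alpha := Set.subset_biUnion_of_mem halphaS
  obtain ⟨beta, hbeta, gamma, hgamma, h⟩ := (hF alpha halphaS).2 L
    (fun delta hdelta => hL delta (hsub hdelta)) _ (hC.inter_Iio halpha)
  exact ⟨beta, ⟨hsub hbeta.1, hbeta.2.1⟩, gamma, ⟨hsub hgamma.1, hgamma.2.1⟩, h⟩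

end LCI
end

section
/- If κ is a subtle cardinal, then for every cardinal λ ≥ κ the set P_κλ is subtle in the sense of Menas. -/
namespace LCI


/-- `P_κ λ` : the collection of subsets of `λ` of size less than `κ`. -/
def Pkl (kappa lam : Cardinal.{0}) : Set (Set Ordinal.{0}) :=
  {x | x ⊆ Set.Iio lam.ord ∧ Cardinal.mk ↥x < Cardinal.lift.{1} kappa}

/-- `C ⊆ P_κ λ` is club : `⊆`-cofinal and closed under unions of `⊆`-increasing
chains of length less than `κ`. -/
def IsClubPkl (kappa lam : Cardinal.{0}) (C : Set (Set Ordinal.{0})) : Prop :=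
  C ⊆ Pkl kappa lam ∧
  (∀ x ∈ Pkl kappa lam, ∃ y ∈ C, x ⊆ y) ∧
  ∀ D : Set (Set Ordinal.{0}), D ⊆ C → D.Nonempty → IsChain (· ⊆ ·) D →
    Cardinal.mk ↥D < Cardinal.lift.{1} kappa → ⋃₀ D ∈ C

/-- `κ_x = |x ∩ κ|`. -/
def kapOf (kappa : Cardinal.{0}) (x : Set Ordinal.{0}) : Cardinal.{1} :=
  Cardinal.mk ↥(x ∩ Set.Iio kappa.ord)

/-- `x < y` iff `x ∈ P_{κ_y} y`. -/
def ltP (kappa : Cardinal.{0}) (x y : Set Ordinal.{0}) : Prop :=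
  x ⊆ y ∧ Cardinal.mk ↥x < kapOf kappa y

/-- `κ` is a subtle cardinal : for every sequence `⟨S_α : α < κ⟩` with `S_α ⊆ α` and
every club `C ⊆ κ` there are `α < β` in `C` with `S_α = S_β ∩ α`. -/
def SubtleCard (kappa : Cardinal.{0}) : Prop :=
  ∀ L : Ordinal.{0} → Set Ordinal.{0}, (∀ alpha, L alpha ⊆ Set.Iio alpha) →
    ∀ C, IsClubIn C kappa.ord →
      ∃ alpha ∈ C, ∃ beta ∈ C, alpha < beta ∧ L alpha = L beta ∩ Set.Iio alpha

/-- `S ⊆ P_κ λ` is subtle in the sense of Menas : for every club `C ⊆ P_κ λ` and every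
function `⟨L x : x ∈ S⟩` with `L x ⊆ x`, there are `x ⊊ y` in `C ∩ S` with
`L x = L y ∩ x`. -/
def MenasSubtle (kappa lam : Cardinal.{0}) (S : Set (Set Ordinal.{0})) : Prop :=
  ∀ L : Set Ordinal.{0} → Set Ordinal.{0}, (∀ x ∈ S, L x ⊆ x) →
    ∀ C, IsClubPkl kappa lam C →
      ∃ x ∈ C ∩ S, ∃ y ∈ C ∩ S, x ⊂ y ∧ L x = L y ∩ x

open Cardinal Ordinal in
/-- A set of fewer than `κ` ordinals below a regular `κ` is strictly bounded below `κ`. -/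
theorem exists_strict_bound {kappa : Cardinal.{0}} (hreg : kappa.IsRegular) {A : Set Ordinal.{0}}
    (hA : A ⊆ Set.Iio kappa.ord) (hcard : #A < Cardinal.lift.{1} kappa) :
    ∃ b < kappa.ord, ∀ a ∈ A, a < b := by
  refine ⟨sSup ((· + 1) '' A), sSup_add_one_lt_of_lt_cof ?_ hA, fun a ha => ?_⟩
  · rwa [← Ordinal.lift_cof, hreg.cof_ord]
  · refine (Order.lt_add_one_iff.2 le_rfl).trans_le (le_csSup ?_ ⟨a, ha, rfl⟩)
    refine ⟨kappa.ord, ?_⟩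
    rintro _ ⟨c, hc, rfl⟩
    exact Order.add_one_le_of_lt (hA hc)

open Cardinal Ordinal in
theorem mk_Iio_lt_lift {kappa : Cardinal.{0}} {alpha : Ordinal.{0}} (h : alpha < kappa.ord) :
    #(Set.Iio alpha) < Cardinal.lift.{1} kappa := by
  rw [Cardinal.mk_Iio_ordinal, Cardinal.lift_lt]
  exact lt_ord.1 h

/-- The ordinals below `κ` closed under an increasing function form a club. -/
theorem isClubIn_closurePoints {kappa : Cardinal.{0}} (hreg : kappa.IsRegular)
    (hunc : Cardinal.aleph0 < kappa) {h : Ordinal.{0} → Ordinal.{0}}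
    (hlt : ∀ alpha < kappa.ord, h alpha < kappa.ord) (hinc : ∀ alpha < kappa.ord, alpha < h alpha) :
    IsClubIn {delta | delta < kappa.ord ∧ 0 < delta ∧ ∀ gamma < delta, h gamma < delta}
      kappa.ord := by
  refine ⟨fun _ hd => hd.1, fun alpha halpha => ?_, fun beta hbeta hne hlim => ?_⟩
  · have hg : ∀ a : Ordinal.{0}, ∃ b, a < kappa.ord →
        b < kappa.ord ∧ ∀ c ≤ a, h c < b := by
      intro a
      by_cases ha : a < kappa.ord
      · have ha' : a + 1 < kappa.ord :=
          (Cardinal.isSuccLimit_ord hreg.aleph0_le).add_one_lt ha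
        obtain ⟨b, hb, hb'⟩ := exists_strict_bound hreg (A := h '' Set.Iio (a + 1))
          (by
            rintro _ ⟨c, hc, rfl⟩
            exact hlt c (lt_trans hc ha'))
          (Cardinal.mk_image_le.trans_lt (mk_Iio_lt_lift ha'))
        exact ⟨b, fun _ => ⟨hb, fun c hc => hb' _ ⟨c, Order.lt_add_one_iff.2 hc, rfl⟩⟩⟩
      · exact ⟨0, fun ha' => absurd ha' ha⟩
    choose g hg using hg
    have hiter : ∀ n : ℕ, g^[n] alpha < kappa.ord := by
      intro n
      induction n with
      | zero => exact halpha
      | succ n ih =>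
        rw [Function.iterate_succ_apply']
        exact (hg _ ih).1
    have hstep : ∀ n : ℕ, ∀ c ≤ g^[n] alpha, h c < g^[n + 1] alpha := by
      intro n c hc
      rw [Function.iterate_succ_apply']
      exact (hg _ (hiter n)).2 c hc
    have hbdd : BddAbove (Set.range fun n : ℕ => g^[n] alpha) :=
      ⟨kappa.ord, by
        rintro _ ⟨n, rfl⟩
        exact (hiter n).le⟩
    have hle : ∀ n : ℕ, g^[n] alpha ≤ ⨆ n : ℕ, g^[n] alpha := fun n => le_ciSup hbdd n
    have hself : ∀ n : ℕ, g^[n] alpha < ⨆ n : ℕ, g^[n] alpha := fun n =>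
      (hinc _ (hiter n)).trans ((hstep n _ le_rfl).trans_le (hle _))
    refine ⟨⨆ n : ℕ, g^[n] alpha, ⟨?_, zero_le.trans_lt (hself 0), fun gamma hgamma => ?_⟩,
      hself 0⟩
    · obtain ⟨b, hb, hb'⟩ := exists_strict_bound hreg (A := Set.range fun n : ℕ => g^[n] alpha)
        (by
          rintro _ ⟨n, rfl⟩
          exact hiter n)
        ((Set.countable_range _).le_aleph0.trans_lt (by simpa using hunc))
      exact (ciSup_le fun n => (hb' _ ⟨n, rfl⟩).le).trans_lt hb
    · obtain ⟨n, hn⟩ := exists_lt_of_lt_ciSup hgamma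
      exact (hstep n _ hn.le).trans_le (hle _)
  · refine ⟨hbeta, pos_iff_ne_zero.2 hne, fun gamma hgamma => ?_⟩
    obtain ⟨delta, hdelta, hgd, hdb⟩ := hlim gamma hgamma
    exact (hdelta.2.2 gamma hgd).trans hdb

/-- No member of a club in `P_κ λ` is maximal in it. -/
theorem IsClubPkl.exists_ssubset {kappa lam : Cardinal.{0}} (hinf : Cardinal.aleph0 ≤ kappa)
    (hlam : kappa ≤ lam) {C : Set (Set Ordinal.{0})} (hC : IsClubPkl kappa lam C)
    {x : Set Ordinal.{0}} (hx : x ∈ C) : ∃ y ∈ C, x ⊂ y := by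
  obtain ⟨hxs, hxc⟩ := hC.1 hx
  obtain ⟨xi, hxi, hxin⟩ : ∃ xi ∈ Set.Iio lam.ord, xi ∉ x := by
    by_contra! hcon
    have := (Cardinal.mk_le_mk_of_subset hcon).trans_lt hxc
    rw [Cardinal.mk_Iio_ordinal, Cardinal.card_ord, Cardinal.lift_lt] at this
    exact this.not_ge hlam
  have hins : insert xi x ∈ Pkl kappa lam := by
    refine ⟨Set.insert_subset hxi hxs, Cardinal.mk_insert_le.trans_lt ?_⟩
    have hk : Cardinal.aleph0 ≤ Cardinal.lift.{1} kappa := by simpa using hinf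
    exact Cardinal.add_lt_of_lt hk hxc (Cardinal.one_lt_aleph0.trans_le hk)
  obtain ⟨y, hy, hxy⟩ := hC.2.1 _ hins
  exact ⟨y, hy, (Set.subset_insert _ _).trans hxy, fun h => hxin (h (hxy (Set.mem_insert _ _)))⟩

/-- Every club in `P_κ λ` contains a continuous strictly increasing chain of length `κ`. -/
theorem IsClubPkl.exists_continuous_chain {kappa lam : Cardinal.{0}} (hreg : kappa.IsRegular)
    (hlam : kappa ≤ lam) {C : Set (Set Ordinal.{0})} (hC : IsClubPkl kappa lam C) :
    ∃ x : Ordinal.{0} → Set Ordinal.{0}, (∀ alpha < kappa.ord, x alpha ∈ C) ∧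
      (∀ alpha < kappa.ord, ∀ beta < alpha, x beta ⊂ x alpha) ∧
      ∀ alpha, Order.IsSuccLimit alpha → x alpha = ⋃ beta ∈ Set.Iio alpha, x beta := by
  have hempty : (∅ : Set Ordinal.{0}) ∈ Pkl kappa lam :=
    ⟨Set.empty_subset _, by simpa using hreg.pos⟩
  obtain ⟨x₀, hx₀, -⟩ := hC.2.1 _ hempty
  have hstep : ∀ z : Set Ordinal.{0}, ∃ y, z ∈ C → y ∈ C ∧ z ⊂ y := by
    intro z
    by_cases hz : z ∈ C
    · obtain ⟨y, hy, hzy⟩ := hC.exists_ssubset hreg.aleph0_le hlam hz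
      exact ⟨y, fun _ => ⟨hy, hzy⟩⟩
    · exact ⟨z, fun h => absurd h hz⟩
  choose s hs using hstep
  let x : Ordinal.{0} → Set Ordinal.{0} := fun alpha =>
    Ordinal.limitRecOn alpha x₀ (fun _ z => s z)
      (fun alpha _ ih => ⋃ beta : Set.Iio alpha, ih beta beta.2)
  have hx_zero : x 0 = x₀ := Ordinal.limitRecOn_zero ..
  have hx_succ : ∀ alpha, x (alpha + 1) = s (x alpha) := fun alpha =>
    Ordinal.limitRecOn_add_one ..
  have hx_lim : ∀ alpha, Order.IsSuccLimit alpha → x alpha = ⋃ beta ∈ Set.Iio alpha, x beta := by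
    intro alpha halpha
    rw [Set.biUnion_eq_iUnion]
    exact Ordinal.limitRecOn_limit (h := halpha) ..
  have key : ∀ alpha < kappa.ord, x alpha ∈ C ∧ ∀ beta < alpha, x beta ⊂ x alpha := by
    intro alpha
    induction alpha using Ordinal.limitRecOn with
    | zero =>
      intro _
      exact ⟨hx_zero ▸ hx₀, fun beta hb => absurd hb not_lt_zero⟩
    | add_one alpha ih =>
      intro halpha
      obtain ⟨hmem, hsub⟩ := ih ((Order.lt_add_one_iff.2 le_rfl).trans halpha)
      rw [hx_succ]
      refine ⟨(hs _ hmem).1, fun beta hb => ?_⟩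
      rcases (Order.lt_add_one_iff.1 hb).eq_or_lt with rfl | hlt
      · exact (hs _ hmem).2
      · exact (hsub beta hlt).trans (hs _ hmem).2
    | limit alpha hlim ih =>
      intro halpha
      refine ⟨?_, fun beta hb => ?_⟩
      · rw [hx_lim alpha hlim, ← Set.sUnion_image]
        refine hC.2.2 _ ?_ ?_ ?_ (Cardinal.mk_image_le.trans_lt (mk_Iio_lt_lift halpha))
        · rintro _ ⟨beta, hb, rfl⟩
          exact (ih beta hb (lt_trans hb halpha)).1
        · exact ⟨_, 0, hlim.bot_lt, rfl⟩
        · rintro _ ⟨b, hb, rfl⟩ _ ⟨c, hc, rfl⟩ hbc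
          rcases lt_trichotomy b c with h | rfl | h
          · exact Or.inl ((ih c hc (lt_trans hc halpha)).2 b h).subset
          · exact absurd rfl hbc
          · exact Or.inr ((ih b hb (lt_trans hb halpha)).2 c h).subset
      · have hb' := hlim.add_one_lt hb
        have h1 := (ih _ hb' (hb'.trans halpha)).2 beta (Order.lt_add_one_iff.2 le_rfl)
        rw [hx_lim alpha hlim]
        exact h1.trans_subset (Set.subset_biUnion_of_mem (u := x) hb')
  exact ⟨x, fun a ha => (key a ha).1, fun a ha => (key a ha).2, hx_lim⟩

/-- A union of `κ` many sets of ordinals of size less than `κ` injects into `κ`. -/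
theorem exists_injOn_iUnion {kappa : Cardinal.{0}} (hinf : Cardinal.aleph0 ≤ kappa)
    {x : Ordinal.{0} → Set Ordinal.{0}}
    (hx : ∀ alpha < kappa.ord, Cardinal.mk (x alpha) < Cardinal.lift.{1} kappa) :
    ∃ f : Ordinal.{0} → Ordinal.{0}, Set.InjOn f (⋃ alpha ∈ Set.Iio kappa.ord, x alpha) ∧
      Set.MapsTo f (⋃ alpha ∈ Set.Iio kappa.ord, x alpha) (Set.Iio kappa.ord) := by
  have hk : Cardinal.aleph0 ≤ Cardinal.lift.{1} kappa := by simpa using hinf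
  have hIio : Cardinal.mk (Set.Iio kappa.ord) = Cardinal.lift.{1} kappa := by
    rw [Cardinal.mk_Iio_ordinal, Cardinal.card_ord]
  have hle : Cardinal.mk (⋃ alpha ∈ Set.Iio kappa.ord, x alpha : Set Ordinal.{0}) ≤
      Cardinal.mk (Set.Iio kappa.ord) := by
    refine (Cardinal.mk_biUnion_le x _).trans ?_
    rw [hIio]
    refine (mul_le_mul_right (ciSup_le' fun a : Set.Iio kappa.ord => ?_) _).trans_eq
      (Cardinal.mul_eq_self hk)
    exact (hx a.1 a.2).le
  obtain ⟨e⟩ := hle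
  classical
  refine ⟨fun xi => if h : xi ∈ _ then e ⟨xi, h⟩ else 0, fun a ha b hb hab => ?_, fun a ha => ?_⟩
  · simp only [dif_pos ha, dif_pos hb] at hab
    exact congrArg Subtype.val (e.injective (Subtype.ext hab))
  · simp only [dif_pos ha]
    exact (e ⟨a, ha⟩).2

/-- For a continuous increasing chain of sets of size less than `κ` and an injection of its union
into `κ`, on a club the stages of the chain are exactly the preimages of ordinals. -/
theorem exists_club_mem_iff_lt {kappa : Cardinal.{0}} (hreg : kappa.IsRegular)
    (hunc : Cardinal.aleph0 < kappa) {x : Ordinal.{0} → Set Ordinal.{0}}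
    (hx : ∀ alpha < kappa.ord, Cardinal.mk (x alpha) < Cardinal.lift.{1} kappa)
    (hmono : ∀ alpha < kappa.ord, ∀ beta < alpha, x beta ⊂ x alpha)
    (hlim : ∀ alpha, Order.IsSuccLimit alpha → x alpha = ⋃ beta ∈ Set.Iio alpha, x beta)
    {f : Ordinal.{0} → Ordinal.{0}}
    (hinj : Set.InjOn f (⋃ alpha ∈ Set.Iio kappa.ord, x alpha))
    (hmaps : Set.MapsTo f (⋃ alpha ∈ Set.Iio kappa.ord, x alpha) (Set.Iio kappa.ord)) :
    ∃ D, IsClubIn D kappa.ord ∧ ∀ delta ∈ D, ∀ xi ∈ ⋃ alpha ∈ Set.Iio kappa.ord, x alpha,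
      xi ∈ x delta ↔ f xi < delta := by
  have hcover : ∀ xi, ∃ a, xi ∈ ⋃ alpha ∈ Set.Iio kappa.ord, x alpha →
      a < kappa.ord ∧ xi ∈ x a := by
    intro xi
    by_cases hxi : xi ∈ ⋃ alpha ∈ Set.Iio kappa.ord, x alpha
    · obtain ⟨a, ha, hxa⟩ := Set.mem_iUnion₂.1 hxi
      exact ⟨a, fun _ => ⟨ha, hxa⟩⟩
    · exact ⟨0, fun h => absurd h hxi⟩
  choose r hr using hcover
  have hh : ∀ alpha, ∃ b, alpha < kappa.ord → b < kappa.ord ∧ alpha < b ∧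
      (∀ xi ∈ x alpha, f xi < b) ∧
      ∀ xi ∈ ⋃ alpha ∈ Set.Iio kappa.ord, x alpha, f xi < alpha → xi ∈ x b := by
    intro alpha
    by_cases halpha : alpha < kappa.ord
    swap
    · exact ⟨0, fun h => absurd h halpha⟩
    obtain ⟨b, hb, hb'⟩ := exists_strict_bound hreg (A := f '' x alpha)
      (by
        rintro _ ⟨xi, hxi, rfl⟩
        exact hmaps (Set.mem_biUnion (t := x) halpha hxi))
      (Cardinal.mk_image_le.trans_lt (hx _ halpha))
    obtain ⟨c, hc, hc'⟩ := exists_strict_bound hreg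
      (A := r '' {xi ∈ ⋃ alpha ∈ Set.Iio kappa.ord, x alpha | f xi < alpha})
      (by
        rintro _ ⟨xi, hxi, rfl⟩
        exact (hr xi hxi.1).1)
      (by
        refine Cardinal.mk_image_le.trans_lt (lt_of_le_of_lt ?_ (mk_Iio_lt_lift halpha))
        refine Cardinal.mk_le_of_injective
          (f := fun z : {xi ∈ ⋃ alpha ∈ Set.Iio kappa.ord, x alpha | f xi < alpha} =>
            (⟨f z.1, z.2.2⟩ : Set.Iio alpha)) fun y z hyz => ?_
        exact Subtype.ext (hinj y.2.1 z.2.1 (congrArg Subtype.val hyz)))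
    have hmax : max (max b c) (alpha + 1) < kappa.ord :=
      max_lt (max_lt hb hc) ((Cardinal.isSuccLimit_ord hreg.aleph0_le).add_one_lt halpha)
    refine ⟨max (max b c) (alpha + 1), fun _ => ⟨hmax, ?_, fun xi hxi => ?_, fun xi hxi hlt => ?_⟩⟩
    · exact (Order.lt_add_one_iff.2 le_rfl).trans_le (le_max_right _ _)
    · exact (hb' _ ⟨xi, hxi, rfl⟩).trans_le ((le_max_left _ _).trans (le_max_left _ _))
    · exact (hmono _ hmax _ ((hc' _ ⟨xi, ⟨hxi, hlt⟩, rfl⟩).trans_le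
        ((le_max_right _ _).trans (le_max_left _ _)))).subset (hr xi hxi).2
  choose h hh using hh
  refine ⟨_, isClubIn_closurePoints hreg hunc (fun a ha => (hh a ha).1) (fun a ha => (hh a ha).2.1),
    ?_⟩
  rintro delta ⟨hdk, hpos, hclosed⟩ xi hxi
  have hdlim : Order.IsSuccLimit delta := by
    refine ⟨fun hmin => hpos.ne' (isMin_iff_eq_bot.1 hmin), fun a ha => ?_⟩
    have hak := ha.lt.trans hdk
    exact ha.2 (hh a hak).2.1 (hclosed a ha.lt)
  constructor
  · intro hxd
    rw [hlim delta hdlim] at hxd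
    obtain ⟨a, ha, hxa⟩ := Set.mem_iUnion₂.1 hxd
    exact ((hh a (lt_trans ha hdk)).2.2.1 xi hxa).trans (hclosed a ha)
  · intro hfd
    have hf := hdlim.add_one_lt hfd
    exact (hmono delta hdk _ (hclosed _ hf)).subset
      ((hh _ (hf.trans hdk)).2.2.2 xi hxi (Order.lt_add_one_iff.2 le_rfl))

/-- Menas. If `κ` is a subtle cardinal then `P_κ λ` is subtle for all
`λ ≥ κ`. -/
theorem menas_pkl_subtle (kappa : Cardinal.{0}) (hreg : kappa.IsRegular)
    (hunc : Cardinal.aleph0 < kappa) (hsub : SubtleCard kappa) :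
    ∀ lam : Cardinal.{0}, kappa ≤ lam → MenasSubtle kappa lam (Pkl kappa lam) := by
  intro lam hlam L hL C hC
  obtain ⟨x, hxC, hmono, hlim⟩ := hC.exists_continuous_chain hreg hlam
  have hx : ∀ alpha < kappa.ord, Cardinal.mk (x alpha) < Cardinal.lift.{1} kappa :=
    fun alpha halpha => (hC.1 (hxC alpha halpha)).2
  obtain ⟨f, hinj, hmaps⟩ := exists_injOn_iUnion hreg.aleph0_le hx
  obtain ⟨D, hD, hDx⟩ := exists_club_mem_iff_lt hreg hunc hx hmono hlim hinj hmaps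
  obtain ⟨alpha, ha, beta, hb, hab, heq⟩ :=
    hsub (fun delta => f '' L (x delta) ∩ Set.Iio delta) (fun _ => Set.inter_subset_right) D hD
  have hLx : ∀ delta ∈ D, L (x delta) ⊆ x delta := fun delta hd =>
    hL _ (hC.1 (hxC delta (hD.1 hd)))
  have hU : ∀ delta ∈ D, x delta ⊆ ⋃ alpha ∈ Set.Iio kappa.ord, x alpha := fun delta hd =>
    Set.subset_biUnion_of_mem (u := x) (hD.1 hd)
  have hmem : ∀ delta ∈ D, x delta ∈ C ∩ Pkl kappa lam := fun delta hd =>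
    ⟨hxC delta (hD.1 hd), hC.1 (hxC delta (hD.1 hd))⟩
  refine ⟨x alpha, hmem alpha ha, x beta, hmem beta hb, hmono beta (hD.1 hb) alpha hab, ?_⟩
  ext xi
  constructor
  · intro hxi
    have hxa := hLx alpha ha hxi
    have hfx : f xi ∈ f '' L (x alpha) ∩ Set.Iio alpha :=
      ⟨⟨xi, hxi, rfl⟩, (hDx alpha ha xi (hU alpha ha hxa)).1 hxa⟩
    obtain ⟨⟨⟨eta, heta, hfe⟩, -⟩, -⟩ := (Set.ext_iff.1 heq _).1 hfx
    rw [hinj (hU beta hb (hLx beta hb heta)) (hU alpha ha hxa) hfe] at heta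
    exact ⟨heta, hxa⟩
  · rintro ⟨hxi, hxa⟩
    have hfa : f xi < alpha := (hDx alpha ha xi (hU alpha ha hxa)).1 hxa
    obtain ⟨⟨eta, heta, hfe⟩, -⟩ :=
      (Set.ext_iff.1 heq _).2 ⟨⟨⟨xi, hxi, rfl⟩, hfa.trans hab⟩, hfa⟩
    rwa [hinj (hU alpha ha (hLx alpha ha heta)) (hU alpha ha hxa) hfe] at heta

end LCI
end
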